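/- Let k ≥ 1 and for each candidate c ∈ C let t_k(c) = ∑_{i ∈ N, c ∈ A_i} 1/min(|A_i|, k) be its individual MSat score with respect to set size k. If W ⊆ C has |W| = k and consists of k candidates with the highest individual MSat scores (i.e., for every c ∈ W and every c' ∈ C \ W, t_k(c) ≥ t_k(c')), then W maximizes MSat among all size-k subsets: MSat(W) ≥ MSat(W') for every W' ⊆ C with |W'| = k. -/

import Mathlib

/-- If every value of `t` on `W` is at least every value off `W`, then `W` maximizes the sum of `t`
among all finsets of the same cardinality. -/
theorem Finset.sum_le_sum_of_card_eq_of_forall_notMem_le {α : Type*} [DecidableEq α] {t : α → ℚ}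
    {W W' : Finset α} (hcard : W'.card = W.card) (htop : ∀ c ∈ W, ∀ c' ∉ W, t c' ≤ t c) :
    ∑ c ∈ W', t c ≤ ∑ c ∈ W, t c := by
  rw [← Finset.sum_sdiff_le_sum_sdiff]
  have hsdiff : (W' \ W).card = (W \ W').card := Finset.card_sdiff_comm hcard
  rcases (W \ W').eq_empty_or_nonempty with h | h
  · have h' : W' \ W = ∅ := by rw [← Finset.card_eq_zero, hsdiff, h, Finset.card_empty]
    rw [h, h']
  · obtain ⟨m, hm, hmin⟩ := Finset.exists_min_image _ t h
    calc ∑ c ∈ W' \ W, t c ≤ (W' \ W).card • t m :=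
          Finset.sum_le_card_nsmul _ _ _ fun c hc =>
            htop m (Finset.mem_sdiff.mp hm).1 c (Finset.mem_sdiff.mp hc).2
      _ = (W \ W').card • t m := by rw [hsdiff]
      _ ≤ ∑ c ∈ W \ W', t c := Finset.card_nsmul_le_sum _ _ _ hmin

/-- A sum of intersection sizes divided by `d` is the sum over candidates of their individual
scores. -/
theorem Finset.sum_card_inter_div_eq_sum_sum_filter {ι α : Type*} [Fintype ι] [DecidableEq α]
    (A : ι → Finset α) (d : ι → ℚ) (W : Finset α) :
    ∑ i, ((W ∩ A i).card : ℚ) / d i =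
      ∑ c ∈ W, ∑ i ∈ Finset.univ.filter (fun i => c ∈ A i), 1 / d i := by
  simp_rw [Finset.sum_filter]
  rw [Finset.sum_comm]
  refine Finset.sum_congr rfl fun i _ => ?_
  rw [← Finset.sum_filter, Finset.filter_mem_eq_inter, Finset.sum_const, nsmul_eq_mul,
    mul_one_div]

/-- if `W` has size `k ≥ 1` and consists of `k` candidates with the highest
individual MSat scores `t_k(c) = ∑_{i : c ∈ A_i} 1 / min(|A_i|, k)`, then `W` maximizes
`MSat(W) = ∑_i |W ∩ A_i| / min(|A_i|, |W|)` among all size-`k` subsets. -/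
theorem msat_top_k_maximizes {n : ℕ} {Cand : Type*} [Fintype Cand] [DecidableEq Cand]
    (A : Fin n → Finset Cand) (hA : ∀ i, (A i).Nonempty)
    (k : ℕ) (hk : 1 ≤ k) (W : Finset Cand) (hW : W.card = k)
    (htop : ∀ c ∈ W, ∀ c' ∉ W,
      (∑ i ∈ Finset.univ.filter (fun i : Fin n => c ∈ A i),
        (1 : ℚ) / (min (A i).card k : ℚ)) ≥
      (∑ i ∈ Finset.univ.filter (fun i : Fin n => c' ∈ A i),
        (1 : ℚ) / (min (A i).card k : ℚ))) :
    ∀ W' : Finset Cand, W'.card = k →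
      (∑ i : Fin n, ((W ∩ A i).card : ℚ) / (min (A i).card W.card : ℚ)) ≥
        (∑ i : Fin n, ((W' ∩ A i).card : ℚ) / (min (A i).card W'.card : ℚ)) := by
  intro W' hW'
  rw [hW, hW', Finset.sum_card_inter_div_eq_sum_sum_filter,
    Finset.sum_card_inter_div_eq_sum_sum_filter]
  exact Finset.sum_le_sum_of_card_eq_of_forall_notMem_le (hW'.trans hW.symm) htop
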